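/- arXiv:1906.05823 — 2 statements merged into one kernel-verified Lean document; each statement's English description precedes it below -/
import Mathlib

section
/- Hoffman's exponential Φ_H is a Hopf algebra isomorphism from the shuffle Hopf algebra (T(𝔄), ⧢, δ) to the quasi-shuffle Hopf algebra (T(𝔄), ⋆, δ): Φ_H(u ⧢ v) = Φ_H(u) ⋆ Φ_H(v) for all u, v, Φ_H(e) = e, δ∘Φ_H = (Φ_H⊗Φ_H)∘δ, and Φ_H is bijective with inverse given by the Hoffman logarithm Φ_H^{−1}(w) = Σ_{(i₁,…,i_p)∈C(ℓ(w))} ((−1)^{ℓ(w)−p}/(i₁⋯i_p)) I[w]. -/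
noncomputable section

open scoped BigOperators

namespace TimeWarp

/-- The free commutative semigroup `𝔄` on the alphabet `A = {1,…,d}` (modelled as `Fin d`):
its elements are the nonempty finite multisets of letters, multiplied by union. -/
abbrev Bracket (d : ℕ) := {m : Multiset (Fin d) // m ≠ 0}

instance {d : ℕ} : Mul (Bracket d) :=
  ⟨fun a b => ⟨a.1 + b.1, fun h => a.2 (by
    have hc := Multiset.card_add a.1 b.1
    rw [h] at hc
    simp at hc
    exact Multiset.card_eq_zero.mp (by omega))⟩⟩

/-- Words with letters in the semigroup `𝔄`; the basis of the tensor algebra `T(𝔄)`. -/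
abbrev Word (d : ℕ) := List (Bracket d)

/-- The tensor algebra `T(𝔄)`, as the free vector space on words. -/
abbrev TA (K : Type*) [Field K] (d : ℕ) := Word d →₀ K

/-- The weight grading: each bracket has weight the number of letters in it. -/
def wordWeight {d : ℕ} (w : Word d) : ℕ := (w.map fun a => Multiset.card a.1).sum

variable {K : Type*} [Field K] {d : ℕ}
/-- Quasi-shuffle product on (reversed) words: the head of the list is the *last* letter
of the word.  `qshRev (u ++ [a]).reverse (v ++ [b]).reverse` encodes
`ua ⋆ vb = (u ⋆ vb)a + (ua ⋆ v)b + (u ⋆ v)[ab]`. -/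
def qshRev : Word d → Word d → TA K d
  | [], v => Finsupp.single v 1
  | u, [] => Finsupp.single u 1
  | a :: u, b :: v =>
      Finsupp.mapDomain (a :: ·) (qshRev u (b :: v)) +
      Finsupp.mapDomain (b :: ·) (qshRev (a :: u) v) +
      Finsupp.mapDomain ((a * b) :: ·) (qshRev u v)
termination_by u v => u.length + v.length
decreasing_by all_goals (simp only [List.length_cons]; omega)

/-- The quasi-shuffle product `u ⋆ v` of two words, an element of `T(𝔄)`. -/
def qshW (u v : Word d) : TA K d :=
  Finsupp.mapDomain List.reverse (qshRev u.reverse v.reverse)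

/-- The bilinear extension of the quasi-shuffle product to all of `T(𝔄)`. -/
def qshL (f g : TA K d) : TA K d :=
  f.sum fun u cu => g.sum fun v cv => (cu * cv) • qshW u v
/-- Shuffle product on (reversed) words: the head of the list is the *last* letter of the
word.  This encodes `ua ⧢ vb = (u ⧢ vb)a + (ua ⧢ v)b`. -/
def shRev : Word d → Word d → TA K d
  | [], v => Finsupp.single v 1
  | u, [] => Finsupp.single u 1
  | a :: u, b :: v =>
      Finsupp.mapDomain (a :: ·) (shRev u (b :: v)) +
      Finsupp.mapDomain (b :: ·) (shRev (a :: u) v)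
termination_by u v => u.length + v.length
decreasing_by all_goals (simp only [List.length_cons]; omega)

/-- The shuffle product `u ⧢ v` of two words, an element of `T(𝔄)`. -/
def shW (u v : Word d) : TA K d :=
  Finsupp.mapDomain List.reverse (shRev u.reverse v.reverse)

/-- The bilinear extension of the shuffle product to all of `T(𝔄)`. -/
def shL (f g : TA K d) : TA K d :=
  f.sum fun u cu => g.sum fun v cv => (cu * cv) • shW u v
/-- Deconcatenation coproduct of a word, as an element of the free vector space on
pairs of words (which realises `T(𝔄) ⊗ T(𝔄)`). -/
def deconcat (w : Word d) : (Word d × Word d) →₀ K :=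
  ∑ i ∈ Finset.range (w.length + 1), Finsupp.single (w.take i, w.drop i) 1

/-- Linear extension of the deconcatenation coproduct. -/
def deconcatL (f : TA K d) : (Word d × Word d) →₀ K :=
  f.sum fun w c => c • deconcat w
/-- Product (in the semigroup `𝔄`) of the letters of a nonempty block. -/
def blockProd : Word d → Option (Bracket d)
  | [] => none
  | a :: t => some (t.foldl (· * ·) a)

/-- `I[w]`: contract the word `w` along the composition `I`, multiplying the letters
inside each block in the semigroup `𝔄`. -/
def Iword {n : ℕ} (c : Composition n) (w : Word d) : Word d :=
  (w.splitWrtComposition c).filterMap blockProd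
/-- Hoffman's exponential `Φ_H` on a word:
`Φ_H(w) = Σ_{(i₁,…,i_p) ∈ C(ℓ(w))} (i₁!⋯i_p!)⁻¹ I[w]`. -/
def hoffExpW (w : Word d) : TA K d :=
  ∑ c : Composition w.length,
    ((c.blocks.map fun i => (i.factorial : K)).prod)⁻¹ • Finsupp.single (Iword c w) 1

/-- Linear extension of Hoffman's exponential to `T(𝔄)`. -/
def hoffExpL (f : TA K d) : TA K d := f.sum fun w c => c • hoffExpW w

/-- The Hoffman logarithm
`Φ_H⁻¹(w) = Σ_{(i₁,…,i_p) ∈ C(ℓ(w))} ((−1)^{ℓ(w)−p}/(i₁⋯i_p)) I[w]`. -/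
def hoffLogW (w : Word d) : TA K d :=
  ∑ c : Composition w.length,
    ((-1 : K) ^ (w.length - c.length) / ((c.blocks.map fun i => ((i : ℕ) : K)).prod)) •
      Finsupp.single (Iword c w) 1

/-- Linear extension of the Hoffman logarithm to `T(𝔄)`. -/
def hoffLogL (f : TA K d) : TA K d := f.sum fun w c => c • hoffLogW w

/-- `(Φ_H ⊗ Φ_H)` applied to an element of `T(𝔄) ⊗ T(𝔄)` (free-vector-space model). -/
def hoffExp2 (F : (Word d × Word d) →₀ K) : (Word d × Word d) →₀ K :=
  F.sum fun p c =>
    (hoffExpW p.1).sum fun w1 c1 =>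
      (hoffExpW p.2).sum fun w2 c2 => Finsupp.single (w1, w2) (c * c1 * c2)

section SplitSum

variable {α M N : Type*} [AddCommMonoid M] [AddCommMonoid N]

/-- The sum of `F x y` over all factorizations `w = x ++ y` of a word. -/
def splitSum (F : List α → List α → M) : List α → M
  | [] => F [] []
  | a :: w => F [] (a :: w) + splitSum (fun x y => F (a :: x) y) w

@[simp] theorem splitSum_nil (F : List α → List α → M) : splitSum F [] = F [] [] := rfl

theorem splitSum_cons (F : List α → List α → M) (a : α) (w : List α) :
    splitSum F (a :: w) = F [] (a :: w) + splitSum (fun x y => F (a :: x) y) w := rfl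

theorem splitSum_eq_sum_range (F : List α → List α → M) (w : List α) :
    splitSum F w = ∑ i ∈ Finset.range (w.length + 1), F (w.take i) (w.drop i) := by
  induction w generalizing F with
  | nil => simp
  | cons a w ih =>
    rw [splitSum_cons, ih, List.length_cons, Finset.sum_range_succ' _ (w.length + 1), add_comm]
    simp

theorem splitSum_congr {F G : List α → List α → M} {w : List α}
    (h : ∀ x y, x ++ y = w → F x y = G x y) :
    splitSum F w = splitSum G w := by
  induction w generalizing F G with
  | nil => exact h [] [] rfl
  | cons a w ih =>
    rw [splitSum_cons, splitSum_cons, h [] (a :: w) rfl]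
    congr 1
    exact ih fun x y hxy => h (a :: x) y (by rw [List.cons_append, hxy])

theorem splitSum_zero (w : List α) : splitSum (fun _ _ => (0 : M)) w = 0 := by
  simp [splitSum_eq_sum_range]

theorem splitSum_add (F G : List α → List α → M) (w : List α) :
    splitSum (fun x y => F x y + G x y) w = splitSum F w + splitSum G w := by
  simp [splitSum_eq_sum_range, Finset.sum_add_distrib]

theorem splitSum_sum {ι : Type*} (s : Finset ι) (F : ι → List α → List α → M) (w : List α) :
    splitSum (fun x y => ∑ i ∈ s, F i x y) w = ∑ i ∈ s, splitSum (F i) w := by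
  simp only [splitSum_eq_sum_range]
  exact Finset.sum_comm

theorem map_splitSum {L : Type*} [FunLike L M N] [AddMonoidHomClass L M N] (f : L)
    (F : List α → List α → M) (w : List α) :
    f (splitSum F w) = splitSum (fun x y => f (F x y)) w := by
  simp [splitSum_eq_sum_range, map_sum]

theorem smul_splitSum {R : Type*} [Semiring R] [Module R M] (c : R) (F : List α → List α → M)
    (w : List α) : c • splitSum F w = splitSum (fun x y => c • F x y) w := by
  simp only [splitSum_eq_sum_range, Finset.smul_sum]

theorem splitSum_smul {R : Type*} [Semiring R] [Module R M] (c : List α → List α → R) (m : M)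
    (w : List α) : splitSum c w • m = splitSum (fun x y => c x y • m) w := by
  simp only [splitSum_eq_sum_range, Finset.sum_smul]

theorem splitSum_mul {R : Type*} [Semiring R] (F : List α → List α → R) (r : R) (w : List α) :
    splitSum F w * r = splitSum (fun x y => F x y * r) w := by
  simp only [splitSum_eq_sum_range, Finset.sum_mul]

theorem splitSum_comm (F : List α → List α → List α → List α → M) (v w : List α) :
    splitSum (fun x y => splitSum (F x y) w) v =
      splitSum (fun x' y' => splitSum (fun x y => F x y x' y') v) w := by
  simp only [splitSum_eq_sum_range]
  exact Finset.sum_comm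

theorem splitSum_coassoc (G : List α → List α → List α → M) (w : List α) :
    splitSum (fun x t => splitSum (fun y z => G x y z) t) w =
      splitSum (fun s z => splitSum (fun x y => G x y z) s) w := by
  induction w generalizing G with
  | nil => rfl
  | cons a w ih =>
    simp only [splitSum_cons, splitSum_nil, ih, splitSum_add, add_assoc]

theorem splitSum_eq_nil_left {F : List α → List α → M} (h : ∀ a x y, F (a :: x) y = 0)
    (w : List α) : splitSum F w = F [] w := by
  cases w with
  | nil => rfl
  | cons a w => simp [splitSum_cons, h, splitSum_zero]

theorem splitSum_reverse (F : List α → List α → M) (w : List α) :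
    splitSum F w.reverse = splitSum (fun x y => F y.reverse x.reverse) w := by
  rw [splitSum_eq_sum_range, splitSum_eq_sum_range, List.length_reverse,
    ← Finset.sum_range_reflect]
  refine Finset.sum_congr rfl fun i hi => ?_
  have hi' : i ≤ w.length := Nat.lt_succ_iff.mp (Finset.mem_range.mp hi)
  rw [List.reverse_drop, List.reverse_take]
  congr 2

theorem splitSum_length (c : ℕ → ℕ → M) (w : List α) :
    splitSum (fun x y => c x.length y.length) w =
      ∑ p ∈ Finset.HasAntidiagonal.antidiagonal w.length, c p.1 p.2 := by
  induction w generalizing c with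
  | nil => simp
  | cons a w ih =>
    rw [splitSum_cons, List.length_cons, Finset.Nat.sum_antidiagonal_succ,
      ← ih fun i j => c (i + 1) j]
    simp

end SplitSum

/-- The composition of `n + 1` with first block `k + 1`, followed by the blocks of `c`. -/
def consComposition {n : ℕ} (k : ℕ) (hk : k ≤ n) (c : Composition (n - k)) :
    Composition (n + 1) where
  blocks := (k + 1) :: c.blocks
  blocks_pos := by
    intro i hi
    rcases List.mem_cons.mp hi with rfl | hi
    · exact Nat.succ_pos k
    · exact c.blocks_pos hi
  blocks_sum := by
    rw [List.sum_cons, c.blocks_sum]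
    omega

theorem sum_composition_succ {M : Type*} [AddCommMonoid M] (n : ℕ) (F : List ℕ → M) :
    ∑ c : Composition (n + 1), F c.blocks =
      ∑ k ∈ Finset.range (n + 1), ∑ c : Composition (n - k), F ((k + 1) :: c.blocks) := by
  rw [Finset.sum_sigma']
  symm
  refine Finset.sum_bij
    (fun p hp => consComposition p.1
      (Nat.lt_succ_iff.mp (Finset.mem_range.mp (Finset.mem_sigma.mp hp).1)) p.2)
    (fun _ _ => Finset.mem_univ _) ?_ ?_ (fun _ _ => rfl)
  · rintro ⟨k, c⟩ _ ⟨k', c'⟩ _ h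
    have h' : k + 1 = k' + 1 ∧ c.blocks = c'.blocks :=
      List.cons_eq_cons.mp (congrArg Composition.blocks h)
    obtain rfl : k = k' := Nat.succ_injective h'.1
    rw [Composition.ext h'.2]
  · intro c _
    obtain ⟨b, hpos, hsum⟩ := c
    cases b with
    | nil => simp at hsum
    | cons k b =>
      have hk : 0 < k := hpos (by simp)
      rw [List.sum_cons] at hsum
      refine ⟨⟨k - 1, ⟨b, fun hi => hpos (by simp [hi]), by omega⟩⟩, by simp; omega, ?_⟩
      apply Composition.ext
      simp [consComposition]
      omega

/-- The product in `𝔄` of the letters of the nonempty word `a :: x`. -/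
def blockLetter (a : Bracket d) (x : Word d) : Bracket d := x.foldl (· * ·) a

/-- Prepending a letter, as a linear map. -/
def consL (K : Type*) [Field K] {d : ℕ} (a : Bracket d) : TA K d →ₗ[K] TA K d :=
  Finsupp.lmapDomain K K (a :: ·)

@[simp] theorem consL_single (a : Bracket d) (w : Word d) (c : K) :
    consL K a (Finsupp.single w c) = Finsupp.single (a :: w) c := by
  simp [consL, Finsupp.mapDomain_single]

/-- The contraction map on words in which a block of size `i` has weight `f i`. -/
def blockSum (f : ℕ → K) (w : Word d) : TA K d :=
  ∑ c : Composition w.length, (c.blocks.map f).prod • Finsupp.single (Iword c w) 1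

@[simp] theorem blockSum_nil (f : ℕ → K) :
    blockSum f ([] : Word d) = Finsupp.single [] 1 := by
  have hb : ∀ c : Composition ([] : Word d).length, c.blocks = [] := fun c => by
    simp
  simp only [blockSum, Iword, List.splitWrtComposition, hb]
  simp [List.splitWrtCompositionAux, composition_card]

theorem blockSum_cons (f : ℕ → K) (a : Bracket d) (w : Word d) :
    blockSum f (a :: w) =
      splitSum (fun x y => f (x.length + 1) • consL K (blockLetter a x) (blockSum f y)) w := by
  rw [splitSum_eq_sum_range]
  have h := sum_composition_succ w.length fun b : List ℕ => (b.map f).prod •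
    (Finsupp.single (((a :: w).splitWrtCompositionAux b).filterMap blockProd) 1 : TA K d)
  refine h.trans (Finset.sum_congr rfl fun k hk => ?_)
  have hk' : k ≤ w.length := Nat.lt_succ_iff.mp (Finset.mem_range.mp hk)
  rw [blockSum, map_sum, Finset.smul_sum, List.length_drop]
  refine Finset.sum_congr rfl fun c _ => ?_
  simp [Iword, List.splitWrtComposition, List.splitWrtCompositionAux, blockProd, blockLetter,
    hk', mul_smul]

section Coalgebra

variable {M : Type*} [AddCommGroup M] [Module K M]

/-- The bilinear extension to `T(𝔄)` of a map defined on pairs of words. -/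
def bilin (K : Type*) [Field K] {d : ℕ} {M : Type*} [AddCommGroup M] [Module K M]
    (H : Word d → Word d → M) : TA K d →ₗ[K] TA K d →ₗ[K] M :=
  Finsupp.linearCombination K fun x => Finsupp.linearCombination K (H x)

theorem bilin_apply (H : Word d → Word d → M) (f g : TA K d) :
    bilin K H f g = f.sum fun u cu => g.sum fun v cv => (cu * cv) • H u v := by
  simp only [bilin, Finsupp.linearCombination_apply, Finsupp.sum, LinearMap.sum_apply,
    LinearMap.smul_apply, Finset.smul_sum, mul_smul]

@[simp] theorem bilin_single (H : Word d → Word d → M) (u v : Word d) (c e : K) :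
    bilin K H (Finsupp.single u c) (Finsupp.single v e) = (c * e) • H u v := by
  simp [bilin, mul_smul]

theorem linearCombination_consL (F : Word d → M) (a : Bracket d) (f : TA K d) :
    Finsupp.linearCombination K F (consL K a f) =
      Finsupp.linearCombination K (fun w => F (a :: w)) f :=
  Finsupp.linearCombination_mapDomain K (a :: ·) f

theorem linearCombination_add_fun (F G : Word d → M) (f : TA K d) :
    Finsupp.linearCombination K (fun w => F w + G w) f =
      Finsupp.linearCombination K F f + Finsupp.linearCombination K G f := by
  simp [Finsupp.linearCombination_apply, Finsupp.sum, Finset.sum_add_distrib]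

theorem linearCombination_smul_fun (c : K) (F : Word d → M) (f : TA K d) :
    Finsupp.linearCombination K (fun w => c • F w) f =
      c • Finsupp.linearCombination K F f := by
  simp [Finsupp.linearCombination_apply, Finsupp.sum, Finset.smul_sum, smul_comm c]

theorem map_linearCombination {N : Type*} [AddCommGroup N] [Module K N] (L : M →ₗ[K] N)
    (F : Word d → M) (f : TA K d) :
    L (Finsupp.linearCombination K F f) = Finsupp.linearCombination K (fun w => L (F w)) f := by
  simp [Finsupp.linearCombination_apply, Finsupp.sum]

theorem splitSum_apply {N : Type*} [AddCommGroup N] [Module K N]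
    (F : Word d → Word d → M →ₗ[K] N) (w : Word d) (m : M) :
    splitSum F w m = splitSum (fun x y => F x y m) w := by
  simp only [splitSum_eq_sum_range, LinearMap.sum_apply]

theorem bilin_single_right (H : Word d → Word d → M) (f : TA K d) (v : Word d) :
    bilin K H f (Finsupp.single v 1) = Finsupp.linearCombination K (fun u => H u v) f := by
  simp [bilin, Finsupp.linearCombination_apply, Finsupp.sum, LinearMap.sum_apply]

theorem bilin_single_left (H : Word d → Word d → M) (u : Word d) (g : TA K d) :
    bilin K H (Finsupp.single u 1) g = Finsupp.linearCombination K (H u) g := by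
  simp [bilin]

theorem bilin_consL (H : Word d → Word d → M) (a : Bracket d) (f g : TA K d) :
    bilin K H (consL K a f) g = bilin K (fun x y => H (a :: x) y) f g := by
  rw [bilin, linearCombination_consL]
  rfl

/-- Contraction maps are morphisms for deconcatenation: the sum of `H` over all factorizations
of the words of `blockSum f w` is the sum over all factorizations of `w`. -/
theorem linearCombination_splitSum_blockSum (f : ℕ → K) (H : Word d → Word d → M)
    (w : Word d) :
    Finsupp.linearCombination K (splitSum H) (blockSum f w) =
      splitSum (fun x y => bilin K H (blockSum f x) (blockSum f y)) w := by
  induction hn : w.length using Nat.strong_induction_on generalizing w H with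
  | _ n ih =>
    cases w with
    | nil => simp
    | cons a w =>
      have hleft : bilin K H (blockSum f []) (blockSum f (a :: w)) =
          Finsupp.linearCombination K (H []) (blockSum f (a :: w)) := by
        rw [blockSum_nil, bilin_single_left]
      rw [splitSum_cons, hleft, blockSum_cons, map_splitSum, map_splitSum]
      have hright : splitSum (fun x y => bilin K H (blockSum f (a :: x)) (blockSum f y)) w =
          splitSum (fun x t => splitSum (fun y z => f (x.length + 1) •
            bilin K (fun p q => H (blockLetter a x :: p) q) (blockSum f y) (blockSum f z)) t)
            w := by
        rw [splitSum_coassoc]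
        congr 1
        funext x y
        simp only [blockSum_cons, map_splitSum, splitSum_apply, map_smul, LinearMap.smul_apply,
          bilin_consL]
      rw [hright, ← splitSum_add]
      refine splitSum_congr fun x y hxy => ?_
      have hl := congrArg List.length hxy
      simp only [List.length_cons, List.length_append] at hn hl
      have hy := ih y.length (by omega) (fun p q => H (blockLetter a x :: p) q) y rfl
      rw [map_smul, map_smul, linearCombination_consL, linearCombination_consL]
      simp only [splitSum_cons]
      rw [linearCombination_add_fun, hy, smul_add]
      congr 1
      exact smul_splitSum _ _ _

/-- The product in the free commutative monoid of all letters of a word. -/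
def content (w : Word d) : Multiset (Fin d) := (w.map Subtype.val).sum

@[simp] theorem content_nil : content ([] : Word d) = 0 := rfl

@[simp] theorem content_cons (a : Bracket d) (w : Word d) :
    content (a :: w) = a.1 + content w := by
  simp [content]

@[simp] theorem content_reverse (w : Word d) : content w.reverse = content w := by
  simp [content, List.sum_reverse]

@[simp] theorem content_append (u v : Word d) :
    content (u ++ v) = content u + content v := by
  simp [content]

theorem bracket_mul_val (a b : Bracket d) : (a * b).1 = a.1 + b.1 := rfl

@[simp] theorem blockLetter_val (a : Bracket d) (x : Word d) :
    (blockLetter a x).1 = a.1 + content x := by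
  induction x generalizing a with
  | nil => simp [blockLetter]
  | cons b x ih =>
    have h := ih (a * b)
    rw [bracket_mul_val] at h
    rw [content_cons, ← add_assoc, ← h]
    rfl

open Classical in
/-- Prepending the letter with a given content; zero for the empty content. -/
def consM (K : Type*) [Field K] {d : ℕ} (s : Multiset (Fin d)) : TA K d →ₗ[K] TA K d :=
  if h : s ≠ 0 then consL K ⟨s, h⟩ else 0

@[simp] theorem consM_zero : consM K (0 : Multiset (Fin d)) = 0 := by
  simp [consM]

@[simp] theorem consM_val (a : Bracket d) : consM K a.1 = consL K a := by
  simp [consM, a.2]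

theorem consL_blockLetter (a : Bracket d) (x : Word d) :
    consL K (blockLetter a x) = consM K (content (a :: x)) := by
  rw [← consM_val, blockLetter_val, content_cons]

open Classical in
theorem blockSum_eq (f : ℕ → K) (w : Word d) :
    blockSum f w = (if w = [] then Finsupp.single [] 1 else 0) +
      splitSum (fun x y => f x.length • consM K (content x) (blockSum f y)) w := by
  cases w with
  | nil => simp
  | cons a w => simp [blockSum_cons, splitSum_cons, consL_blockLetter]

open PowerSeries in
/-- Summing over `blockSum f x` a quantity depending only on length and content. -/
theorem linearCombination_length_content {f : ℕ → K} {P : K⟦X⟧} (hP₀ : coeff 0 P = 0)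
    (hP : ∀ n, coeff (n + 1) P = f (n + 1)) (φ : ℕ → K) (ψ : Multiset (Fin d) → M)
    (x : Word d) {N : ℕ} (hN : x.length < N) :
    Finsupp.linearCombination K (fun z : Word d => φ z.length • ψ (content z)) (blockSum f x) =
      (∑ p ∈ Finset.range N, coeff x.length (P ^ p) * φ p) • ψ (content x) := by
  induction N generalizing x φ ψ with
  | zero => omega
  | succ N ih =>
    rw [Finset.sum_range_succ']
    cases x with
    | nil =>
      have h0 : constantCoeff P = 0 := by simpa using hP₀
      simp [h0]
    | cons a x =>
      simp only [List.length_cons] at hN ⊢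
      have hone : coeff (x.length + 1) (P ^ 0) = 0 := by simp [coeff_one]
      rw [hone, zero_mul, add_zero, blockSum_cons, map_splitSum]
      have hpow : ∀ p, coeff (x.length + 1) (P ^ (p + 1)) =
          splitSum (fun s t : Word d => f (s.length + 1) * coeff t.length (P ^ p)) x := by
        intro p
        rw [splitSum_length fun i j => f (i + 1) * coeff j (P ^ p), pow_succ', coeff_mul,
          Finset.Nat.sum_antidiagonal_succ]
        simp [hP, hP₀]
      have hterm : ∀ s t : Word d, s ++ t = x →
          Finsupp.linearCombination K (fun z : Word d => φ z.length • ψ (content z))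
            (f (s.length + 1) • consL K (blockLetter a s) (blockSum f t)) =
          (∑ p ∈ Finset.range N, f (s.length + 1) * coeff t.length (P ^ p) * φ (p + 1)) •
            ψ (a.1 + content x) := by
        intro s t hst
        have hl := congrArg List.length hst
        rw [List.length_append] at hl
        rw [map_smul, linearCombination_consL]
        simp only [List.length_cons, content_cons, blockLetter_val]
        rw [ih (fun n => φ (n + 1)) (fun m => ψ (a.1 + content s + m)) t (by omega), smul_smul,
          Finset.mul_sum, ← hst, content_append, add_assoc]
        simp only [mul_assoc]
      rw [splitSum_congr hterm, content_cons, ← splitSum_smul, splitSum_sum]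
      congr 1
      refine Finset.sum_congr rfl fun p _ => ?_
      rw [hpow, splitSum_mul]

end Coalgebra

section Shuffle

theorem linearCombination_single_one (f : TA K d) :
    Finsupp.linearCombination K (fun w => (Finsupp.single w 1 : TA K d)) f = f := by
  simp [Finsupp.linearCombination_apply]

@[simp] theorem shRev_nil_left (v : Word d) : shRev (K := K) [] v = Finsupp.single v 1 := by
  rw [shRev]

@[simp] theorem shRev_nil_right (u : Word d) : shRev (K := K) u [] = Finsupp.single u 1 := by
  cases u <;> simp [shRev]

theorem shRev_cons_cons (a b : Bracket d) (u v : Word d) :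
    shRev (K := K) (a :: u) (b :: v) =
      consL K a (shRev u (b :: v)) + consL K b (shRev (a :: u) v) := by
  rw [shRev]
  rfl

@[simp] theorem qshRev_nil_left (v : Word d) : qshRev (K := K) [] v = Finsupp.single v 1 := by
  rw [qshRev]

@[simp] theorem qshRev_nil_right (u : Word d) : qshRev (K := K) u [] = Finsupp.single u 1 := by
  cases u <;> simp [qshRev]

theorem qshRev_cons_cons (a b : Bracket d) (u v : Word d) :
    qshRev (K := K) (a :: u) (b :: v) =
      consL K a (qshRev u (b :: v)) + consL K b (qshRev (a :: u) v) +
        consL K (a * b) (qshRev u v) := by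
  rw [qshRev]
  rfl

theorem bilin_qshRev_consL (a b : Bracket d) (f g : TA K d) :
    bilin K (qshRev (K := K)) (consL K a f) (consL K b g) =
      consL K a (bilin K (qshRev (K := K)) f (consL K b g)) +
        consL K b (bilin K (qshRev (K := K)) (consL K a f) g) +
        consL K (a * b) (bilin K (qshRev (K := K)) f g) := by
  induction f using Finsupp.induction_linear with
  | zero => simp
  | add f₁ f₂ h₁ h₂ =>
    simp only [map_add, LinearMap.add_apply, h₁, h₂]
    abel
  | single u c =>
    induction g using Finsupp.induction_linear with
    | zero => simp
    | add g₁ g₂ h₁ h₂ =>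
      simp only [map_add, h₁, h₂]
      abel
    | single v e => simp [qshRev_cons_cons]

/-- Deconcatenation is a morphism for the shuffle product, tested against functionals that
depend on the left factor only through its length and content. -/
theorem linearCombination_splitSum_shRev {M : Type*} [AddCommGroup M] [Module K M]
    (A : ℕ → Multiset (Fin d) → Word d → M) (u v : Word d) :
    Finsupp.linearCombination K (splitSum fun x y => A x.length (content x) y) (shRev u v) =
      splitSum (fun x y => splitSum (fun x' y' =>
        ((x.length + x'.length).choose x.length : K) •
          Finsupp.linearCombination K (A (x.length + x'.length) (content x + content x'))
            (shRev y y')) v) u := by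
  induction hn : u.length + v.length using Nat.strong_induction_on generalizing u v A with
  | _ n ih =>
    cases u with
    | nil => simp
    | cons a u =>
      cases v with
      | nil => simp
      | cons b v =>
        simp only [List.length_cons] at hn
        have h₁ := ih (u.length + (v.length + 1)) (by omega)
          (fun n s => A (n + 1) (a.1 + s)) u (b :: v) rfl
        have h₂ := ih (u.length + 1 + v.length) (by omega)
          (fun n s => A (n + 1) (b.1 + s)) (a :: u) v rfl
        have h₀ := congrArg (Finsupp.linearCombination K (A 0 0)) (shRev_cons_cons a b u v)
        rw [map_add, linearCombination_consL, linearCombination_consL] at h₀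
        rw [shRev_cons_cons, map_add, linearCombination_consL, linearCombination_consL]
        simp only [splitSum_cons, List.length_cons, List.length_nil, content_nil, content_cons,
          linearCombination_add_fun, splitSum_add] at h₁ h₂ ⊢
        rw [h₁, h₂]
        simp only [Nat.choose_self, Nat.choose_zero_right,
          Nat.cast_one, one_smul, add_zero, zero_add]
        rw [h₀]
        have hpascal : ∀ (x x' y y' : Word d),
            ((x.length + 1 + (x'.length + 1)).choose (x.length + 1) : K) •
              Finsupp.linearCombination K
                (A (x.length + 1 + (x'.length + 1)) (a.1 + content x + (b.1 + content x')))
                (shRev y y') =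
            ((x.length + (x'.length + 1)).choose x.length : K) •
              Finsupp.linearCombination K
                (A (x.length + (x'.length + 1) + 1) (a.1 + (content x + (b.1 + content x'))))
                (shRev y y') +
            ((x.length + 1 + x'.length).choose (x.length + 1) : K) •
              Finsupp.linearCombination K
                (A (x.length + 1 + x'.length + 1) (b.1 + (a.1 + content x + content x')))
                (shRev y y') := by
          intro x x' y y'
          have e₁ : x.length + (x'.length + 1) = x.length + 1 + x'.length := by omega
          have e₂ : x.length + 1 + (x'.length + 1) = x.length + 1 + x'.length + 1 := by omega
          have e₃ : a.1 + (content x + (b.1 + content x')) =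
            a.1 + content x + (b.1 + content x') := by abel
          have e₄ : b.1 + (a.1 + content x + content x') =
            a.1 + content x + (b.1 + content x') := by abel
          rw [e₁, e₂, e₃, e₄, ← add_smul, ← Nat.cast_add, ← Nat.choose_succ_succ]
        simp only [hpascal, splitSum_add]
        abel

theorem consL_blockLetter_mul (a b : Bracket d) (x y : Word d) :
    consL K (blockLetter a x * blockLetter b y) = consM K (content (a :: x) + content (b :: y)) := by
  rw [← consM_val, bracket_mul_val, blockLetter_val, blockLetter_val, content_cons, content_cons]

theorem linearCombination_blockSum_shRev_cons_cons {f : ℕ → K}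
    (hf : ∀ i j, ((i + j).choose i : K) * f (i + j) = f i * f j) (hf₀ : f 0 = 1)
    (a b : Bracket d) (u v : Word d) :
    Finsupp.linearCombination K (blockSum f) (shRev (a :: u) (b :: v)) =
      splitSum (fun x y => f (x.length + 1) • consL K (blockLetter a x)
        (Finsupp.linearCombination K (blockSum f) (shRev y (b :: v)))) u +
      splitSum (fun x' y' => f (x'.length + 1) • consL K (blockLetter b x')
        (Finsupp.linearCombination K (blockSum f) (shRev (a :: u) y'))) v +
      splitSum (fun x y => splitSum (fun x' y' => f (x.length + 1) • f (x'.length + 1) •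
        consL K (blockLetter a x * blockLetter b x')
          (Finsupp.linearCombination K (blockSum f) (shRev y y'))) v) u := by
  have hsum : (blockSum f : Word d → TA K d) = fun w =>
      (if w = [] then Finsupp.single [] 1 else 0) +
        splitSum (fun x y => f x.length • consM K (content x) (blockSum f y)) w :=
    funext (blockSum_eq f)
  have hnil : Finsupp.linearCombination K
      (fun w : Word d => if w = [] then (Finsupp.single [] 1 : TA K d) else 0)
      (shRev (a :: u) (b :: v)) = 0 := by
    rw [shRev_cons_cons, map_add, linearCombination_consL, linearCombination_consL]
    simp [Finsupp.linearCombination_apply]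
  conv_lhs => rw [hsum]
  rw [linearCombination_add_fun, hnil, zero_add,
    linearCombination_splitSum_shRev (fun n s y => f n • consM K s (blockSum f y) :
      ℕ → Multiset (Fin d) → Word d → TA K d)]
  simp only [linearCombination_smul_fun]
  simp only [← map_linearCombination (K := K), smul_smul, hf]
  simp only [mul_smul, splitSum_cons, splitSum_add, List.length_nil, List.length_cons,
    content_nil, add_zero, zero_add, consM_zero, LinearMap.zero_apply, smul_zero, hf₀, one_smul,
    consL_blockLetter, consL_blockLetter_mul]
  abel

theorem bilin_qshRev_blockSum_cons_cons (f : ℕ → K) (a b : Bracket d) (u v : Word d) :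
    bilin K (qshRev (K := K)) (blockSum f (a :: u)) (blockSum f (b :: v)) =
      splitSum (fun x y => f (x.length + 1) • consL K (blockLetter a x)
        (bilin K qshRev (blockSum f y) (blockSum f (b :: v)))) u +
      splitSum (fun x' y' => f (x'.length + 1) • consL K (blockLetter b x')
        (bilin K qshRev (blockSum f (a :: u)) (blockSum f y'))) v +
      splitSum (fun x y => splitSum (fun x' y' => f (x.length + 1) • f (x'.length + 1) •
        consL K (blockLetter a x * blockLetter b x')
          (bilin K qshRev (blockSum f y) (blockSum f y'))) v) u := by
  have hswap : ∀ G : Word d → Word d → Word d → Word d → TA K d,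
      splitSum (fun x' y' => splitSum (fun x y =>
        f (x'.length + 1) • f (x.length + 1) • G x y x' y') u) v =
      splitSum (fun x y => splitSum (fun x' y' =>
        f (x.length + 1) • f (x'.length + 1) • G x y x' y') v) u := by
    intro G
    rw [splitSum_comm]
    congr 1
    funext x y
    congr 1
    funext x' y'
    exact smul_comm _ _ _
  simp only [blockSum_cons, map_smul, map_splitSum, splitSum_apply, LinearMap.smul_apply,
    smul_splitSum]
  rw [hswap fun x y x' y' => bilin K qshRev (consL K (blockLetter a x) (blockSum f y))
      (consL K (blockLetter b x') (blockSum f y')),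
    hswap fun x y x' y' => consL K (blockLetter b x')
      (bilin K qshRev (consL K (blockLetter a x) (blockSum f y)) (blockSum f y'))]
  simp only [bilin_qshRev_consL, smul_add, splitSum_add]

/-- The contraction map with weights `1 / i!` turns shuffles into quasi-shuffles. -/
theorem linearCombination_blockSum_shRev {f : ℕ → K}
    (hf : ∀ i j, ((i + j).choose i : K) * f (i + j) = f i * f j) (hf₀ : f 0 = 1)
    (u v : Word d) :
    Finsupp.linearCombination K (blockSum f) (shRev u v) =
      bilin K qshRev (blockSum f u) (blockSum f v) := by
  induction hn : u.length + v.length using Nat.strong_induction_on generalizing u v with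
  | _ n ih =>
    cases u with
    | nil =>
      have h : qshRev (K := K) ([] : Word d) = fun v => Finsupp.single v 1 :=
        funext qshRev_nil_left
      rw [blockSum_nil, bilin_single_left, h, linearCombination_single_one]
      simp
    | cons a u =>
      cases v with
      | nil =>
        simp only [blockSum_nil, bilin_single_right, qshRev_nil_right]
        rw [linearCombination_single_one]
        simp
      | cons b v =>
        simp only [List.length_cons] at hn
        rw [linearCombination_blockSum_shRev_cons_cons hf hf₀, bilin_qshRev_blockSum_cons_cons]
        refine congrArg₂ _ (congrArg₂ _ ?_ ?_) ?_
        · refine splitSum_congr fun x y hxy => ?_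
          rw [← hxy, List.length_append] at hn
          rw [ih (y.length + (v.length + 1)) (by omega) y (b :: v) rfl]
        · refine splitSum_congr fun x' y' hxy' => ?_
          rw [← hxy', List.length_append] at hn
          rw [ih (u.length + 1 + y'.length) (by omega) (a :: u) y' rfl]
        · refine splitSum_congr fun x y hxy => splitSum_congr fun x' y' hxy' => ?_
          rw [← hxy, ← hxy', List.length_append, List.length_append] at hn
          rw [ih (y.length + y'.length) (by omega) y y' rfl]

end Shuffle

section Inverse

open Classical in
theorem linearCombination_counit_blockSum (f : ℕ → K) (w : Word d) :
    Finsupp.linearCombination K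
      (fun z : Word d => if z = [] then (Finsupp.single [] 1 : TA K d) else 0) (blockSum f w) =
      if w = [] then Finsupp.single [] 1 else 0 := by
  cases w with
  | nil => simp
  | cons a w =>
    rw [blockSum_cons, map_splitSum]
    simp only [map_smul, linearCombination_consL]
    simp [Finsupp.linearCombination_apply, splitSum_zero]

theorem bilin_apply_left (A : Word d → TA K d →ₗ[K] TA K d) (B : Word d → TA K d)
    (f g : TA K d) :
    bilin K (fun x y => A x (B y)) f g =
      Finsupp.linearCombination K A f (Finsupp.linearCombination K B g) := by
  simp only [bilin, Finsupp.linearCombination_apply, Finsupp.sum, LinearMap.sum_apply,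
    LinearMap.smul_apply, map_sum, map_smul, Finset.smul_sum]
  rw [Finset.sum_comm]
  exact Finset.sum_congr rfl fun _ _ => Finset.sum_congr rfl fun _ _ => smul_comm _ _ _

theorem bilin_apply_right (A : Word d → TA K d →ₗ[K] TA K d) (B : Word d → TA K d)
    (f g : TA K d) :
    bilin K (fun x y => A y (B x)) f g =
      Finsupp.linearCombination K A g (Finsupp.linearCombination K B f) := by
  simp only [bilin, Finsupp.linearCombination_apply, Finsupp.sum, LinearMap.sum_apply,
    LinearMap.smul_apply, map_sum, map_smul, Finset.smul_sum]

open PowerSeries in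
/-- Contraction maps compose to the identity when the corresponding series do. -/
theorem linearCombination_blockSum_blockSum {f g : ℕ → K} {P : K⟦X⟧} (hP₀ : coeff 0 P = 0)
    (hP : ∀ n, coeff (n + 1) P = f (n + 1))
    (hcomp : ∀ n, ∑ p ∈ Finset.range (n + 2), coeff (n + 1) (P ^ p) * g p =
      if n = 0 then 1 else 0) (w : Word d) :
    Finsupp.linearCombination K (blockSum g) (blockSum f w) = Finsupp.single w 1 := by
  classical
  induction hn : w.length using Nat.strong_induction_on generalizing w with
  | _ n ih =>
    have hsum : (blockSum g : Word d → TA K d) = fun w =>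
        (if w = [] then Finsupp.single [] 1 else 0) +
          splitSum (fun x y => (g x.length • consM K (content x)) (blockSum g y)) w :=
      funext (blockSum_eq g)
    cases w with
    | nil => simp
    | cons a w =>
      conv_lhs => rw [hsum]
      rw [linearCombination_add_fun, linearCombination_counit_blockSum,
        linearCombination_splitSum_blockSum]
      simp only [bilin_apply_left]
      have hlin : ∀ x : Word d, Finsupp.linearCombination K
          (fun z : Word d => g z.length • consM K (content z)) (blockSum f x) =
          (∑ p ∈ Finset.range (x.length + 1), coeff x.length (P ^ p) * g p) •
            consM K (content x) :=
        fun x => linearCombination_length_content hP₀ hP g (consM K) x (Nat.lt_succ_self _)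
      simp only [hlin, splitSum_cons, content_nil, consM_zero, smul_zero, LinearMap.zero_apply,
        List.length_cons, hcomp]
      rw [splitSum_eq_nil_left (by simp)]
      rw [ih w.length (by simp [← hn]) w rfl]
      simp

theorem linearCombination_reverse (f : TA K d) :
    Finsupp.linearCombination K (fun z : Word d => (Finsupp.single z.reverse 1 : TA K d)) f =
      Finsupp.mapDomain List.reverse f := by
  simp [Finsupp.linearCombination_apply, Finsupp.mapDomain]

open Classical in
theorem single_reverse_eq (z : Word d) :
    (Finsupp.single z.reverse 1 : TA K d) = (if z = [] then Finsupp.single [] 1 else 0) +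
      splitSum (fun x y => ((if y.length = 1 then (1 : K) else 0) • consM K (content y))
        (Finsupp.single x.reverse 1)) z := by
  obtain ⟨w, rfl⟩ : ∃ w : Word d, z = w.reverse := ⟨z.reverse, by simp⟩
  rw [splitSum_reverse]
  cases w with
  | nil => simp
  | cons a w =>
    rw [splitSum_cons, splitSum_eq_nil_left (by simp)]
    simp

open PowerSeries in
theorem blockSum_reverse (f : ℕ → K) (w : Word d) :
    blockSum f w.reverse = Finsupp.mapDomain List.reverse (blockSum f w) := by
  classical
  induction hn : w.length using Nat.strong_induction_on generalizing w with
  | _ n ih =>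
    have hsum : (fun z : Word d => (Finsupp.single z.reverse 1 : TA K d)) = _ :=
      funext single_reverse_eq
    let P : K⟦X⟧ := PowerSeries.mk fun n => if n = 0 then 0 else f n
    have hlin : ∀ y : Word d, Finsupp.linearCombination K
        (fun z : Word d => (if z.length = 1 then (1 : K) else 0) • consM K (content z))
          (blockSum f y) = f y.length • consM K (content y) := by
      intro y
      rw [linearCombination_length_content (P := P) (by simp [P]) (by simp [P])
        (fun n => if n = 1 then 1 else 0) (consM K) y (N := y.length + 2) (by omega)]
      cases y with
      | nil => simp
      | cons b y => simp [P]
    rw [← linearCombination_reverse, hsum, linearCombination_add_fun,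
      linearCombination_counit_blockSum, linearCombination_splitSum_blockSum, blockSum_eq,
      splitSum_reverse]
    simp only [bilin_apply_right, hlin, List.reverse_eq_nil_iff, linearCombination_reverse]
    congr 1
    refine splitSum_congr fun x y hxy => ?_
    cases y with
    | nil => simp
    | cons b y =>
      have hl := congrArg List.length hxy
      simp only [List.length_append, List.length_cons] at hl
      rw [ih x.length (by omega) x rfl, content_reverse, List.length_reverse]
      rfl

end Inverse

section Coefficients

open PowerSeries

theorem coeff_pow_eq_zero_of_lt {P : K⟦X⟧} (hP : coeff 0 P = 0) {n k : ℕ} (h : n < k) :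
    coeff n (P ^ k) = 0 := by
  have hX : (X : K⟦X⟧) ∣ P := by
    rw [X_dvd_iff]
    simpa using hP
  exact (X_pow_dvd_iff.mp (pow_dvd_pow_of_dvd hX k)) n h

/-- The weight of a block of size `n` in the Hoffman logarithm. -/
def logWeight (K : Type*) [Field K] (n : ℕ) : K := (-1) ^ (n - 1) / n

theorem log_comp_exp_coeff [CharZero K] {E : K⟦X⟧} (hE₀ : coeff 0 E = 0)
    (hE : ∀ n, coeff (n + 1) E = ((n + 1).factorial : K)⁻¹) (n : ℕ) :
    ∑ p ∈ Finset.range (n + 2), coeff (n + 1) (E ^ p) * logWeight K p =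
      if n = 0 then 1 else 0 := by
  have hd : d⁄dX K E = 1 + E := by
    ext m
    rw [coeff_derivative, hE, map_add, Nat.factorial_succ]
    have hm : (m + 1 : K) ≠ 0 := Nat.cast_add_one_ne_zero m
    have hm' : (m.factorial : K) ≠ 0 := Nat.cast_ne_zero.mpr m.factorial_ne_zero
    cases m with
    | zero => simp [hE₀]
    | succ m =>
      rw [hE, coeff_one, if_neg (Nat.succ_ne_zero m)]
      push_cast at hm ⊢
      field_simp
      ring
  have hn : (n + 1 : K) ≠ 0 := Nat.cast_add_one_ne_zero n
  have hpow : ∀ p, coeff (n + 1) (E ^ (p + 1)) * logWeight K (p + 1) * (n + 1) =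
      (-1) ^ p * coeff n (E ^ p) - (-1) ^ (p + 1) * coeff n (E ^ (p + 1)) := by
    intro p
    have h := coeff_derivative (E ^ (p + 1)) n
    have hp : (p + 1 : K) ≠ 0 := Nat.cast_add_one_ne_zero p
    have hmul : d⁄dX K (E ^ (p + 1)) = C (p + 1 : K) * (E ^ p + E ^ (p + 1)) := by
      rw [derivative_pow, hd]
      simp only [map_add, map_one, map_natCast]
      push_cast
      ring
    rw [hmul, coeff_C_mul, map_add] at h
    rw [mul_right_comm, ← h, logWeight]
    push_cast
    field_simp
    ring
  have hzero : logWeight K 0 = 0 := by simp [logWeight]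
  refine mul_right_cancel₀ hn ?_
  rw [Finset.sum_range_succ', hzero, mul_zero, add_zero, Finset.sum_mul,
    Finset.sum_congr rfl fun p _ => hpow p, Finset.sum_range_sub',
    coeff_pow_eq_zero_of_lt hE₀ (Nat.lt_succ_self n)]
  rcases eq_or_ne n 0 with rfl | h
  · simp
  · simp [coeff_one, h]

theorem exp_comp_log_coeff [CharZero K] {L : K⟦X⟧} (hL₀ : coeff 0 L = 0)
    (hL : ∀ n, coeff (n + 1) L = logWeight K (n + 1)) (n : ℕ) :
    ∑ p ∈ Finset.range (n + 2), coeff (n + 1) (L ^ p) * (p.factorial : K)⁻¹ =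
      if n = 0 then 1 else 0 := by
  have hd : (1 + X) * d⁄dX K L = 1 := by
    have hcoeff : ∀ m, coeff m (d⁄dX K L) = (-1) ^ m := by
      intro m
      have hm : (m + 1 : K) ≠ 0 := Nat.cast_add_one_ne_zero m
      rw [coeff_derivative, hL, logWeight]
      push_cast
      rw [div_mul_cancel₀ _ hm]
    ext m
    rw [add_mul, one_mul, map_add]
    cases m with
    | zero => simpa using hcoeff 0
    | succ m =>
      rw [coeff_succ_X_mul, hcoeff, hcoeff, coeff_one, if_neg (Nat.succ_ne_zero m)]
      ring
  let H : ℕ → K⟦X⟧ := fun N => ∑ p ∈ Finset.range N, C (p.factorial : K)⁻¹ * L ^ p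
  have hH : ∀ N, (1 + X) * d⁄dX K (H (N + 1)) = H N := by
    intro N
    simp only [H]
    rw [Finset.sum_range_succ', map_add, map_sum, mul_add, Finset.mul_sum]
    have h0 : d⁄dX K (C ((Nat.factorial 0 : ℕ) : K)⁻¹ * L ^ 0) = 0 := by simp
    rw [h0, mul_zero, add_zero]
    refine Finset.sum_congr rfl fun p _ => ?_
    have hp : (p + 1 : K) ≠ 0 := Nat.cast_add_one_ne_zero p
    have hc : C ((p + 1).factorial : K)⁻¹ * ((p + 1 : ℕ) : K⟦X⟧) = C (p.factorial : K)⁻¹ := by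
      rw [← map_natCast (C (R := K)), ← map_mul, Nat.factorial_succ]
      congr 1
      push_cast
      field_simp
    rw [Derivation.leibniz, derivative_pow, derivative_C]
    simp only [Nat.add_sub_cancel, smul_eq_mul, mul_zero, add_zero]
    calc _ = (C ((p + 1).factorial : K)⁻¹ * ((p + 1 : ℕ) : K⟦X⟧)) * L ^ p *
          ((1 + X) * d⁄dX K L) := by ring
      _ = _ := by rw [hc, hd, mul_one]
  have hcoeff : ∀ m N, m < N → coeff m (H N) = if m ≤ 1 then 1 else 0 := by
    intro m
    induction m with
    | zero =>
      intro N hN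
      obtain ⟨N, rfl⟩ : ∃ k, N = k + 1 := ⟨N - 1, by omega⟩
      have h0 : constantCoeff L = 0 := by simpa using hL₀
      simp [H, Finset.sum_range_succ', h0]
    | succ m ih =>
      intro N hN
      obtain ⟨N, rfl⟩ : ∃ k, N = k + 1 := ⟨N - 1, by omega⟩
      have h := congrArg (coeff m) (hH N)
      have hm : (m + 1 : K) ≠ 0 := Nat.cast_add_one_ne_zero m
      rw [add_mul, one_mul, map_add, coeff_derivative, ih N (by omega)] at h
      refine mul_right_cancel₀ hm ?_
      cases m with
      | zero => simpa using h
      | succ m =>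
        rw [coeff_succ_X_mul, coeff_derivative, ih (N + 1) (by omega)] at h
        rw [if_neg (by omega), zero_mul]
        cases m with
        | zero => simpa using h
        | succ m => simpa using h
  have h := hcoeff (n + 1) (n + 2) (by omega)
  simp only [H, map_sum, coeff_C_mul] at h
  rw [Finset.sum_congr rfl fun p _ => mul_comm _ _, h]
  simp

theorem prod_logWeight (b : List ℕ) (hb : ∀ i ∈ b, 0 < i) :
    b.length ≤ b.sum ∧ (b.map (logWeight K)).prod =
      (-1) ^ (b.sum - b.length) / (b.map fun i => ((i : ℕ) : K)).prod := by
  induction b with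
  | nil => simp
  | cons i b ih =>
    obtain ⟨hle, hprod⟩ := ih fun j hj => hb j (List.mem_cons_of_mem i hj)
    have hi : 0 < i := hb i List.mem_cons_self
    have hexp : (i :: b).sum - (i :: b).length = (i - 1) + (b.sum - b.length) := by
      simp only [List.sum_cons, List.length_cons]
      omega
    refine ⟨by simp only [List.sum_cons, List.length_cons]; omega, ?_⟩
    rw [hexp, List.map_cons, List.prod_cons, hprod, List.map_cons, List.prod_cons, pow_add,
      logWeight, div_mul_div_comm]

end Coefficients

theorem hoffExpW_eq_blockSum (w : Word d) :
    hoffExpW (K := K) w = blockSum (fun i => (i.factorial : K)⁻¹) w := by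
  refine Finset.sum_congr rfl fun c _ => ?_
  rw [List.prod_inv, List.map_map]
  rfl

theorem hoffLogW_eq_blockSum (w : Word d) :
    hoffLogW (K := K) w = blockSum (logWeight K) w := by
  refine Finset.sum_congr rfl fun c _ => ?_
  rw [(prod_logWeight c.blocks fun i hi => c.blocks_pos hi).2, c.blocks_sum, c.blocks_length]

theorem hoffExpL_eq_linearCombination (f : TA K d) :
    hoffExpL f = Finsupp.linearCombination K (blockSum fun i => (i.factorial : K)⁻¹) f := by
  simp only [hoffExpL, hoffExpW_eq_blockSum, Finsupp.linearCombination_apply]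

theorem hoffLogL_eq_linearCombination (f : TA K d) :
    hoffLogL f = Finsupp.linearCombination K (blockSum (logWeight K)) f := by
  simp only [hoffLogL, hoffLogW_eq_blockSum, Finsupp.linearCombination_apply]

theorem hoffExpL_hoffLogL [CharZero K] (f : TA K d) : hoffExpL (hoffLogL f) = f := by
  rw [hoffExpL_eq_linearCombination, hoffLogL_eq_linearCombination, map_linearCombination]
  have hzero : logWeight K 0 = 0 := by simp [logWeight]
  simp only [linearCombination_blockSum_blockSum (P := PowerSeries.mk (logWeight K))
    (f := logWeight K) (by simp [hzero]) (by simp)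
    (exp_comp_log_coeff (by simp [hzero]) (by simp))]
  exact linearCombination_single_one f

theorem hoffLogL_hoffExpL [CharZero K] (f : TA K d) : hoffLogL (hoffExpL f) = f := by
  rw [hoffExpL_eq_linearCombination, hoffLogL_eq_linearCombination, map_linearCombination]
  simp only [linearCombination_blockSum_blockSum
    (P := PowerSeries.mk fun i => if i = 0 then 0 else (i.factorial : K)⁻¹)
    (f := fun i => (i.factorial : K)⁻¹) (by simp) (by simp)
    (log_comp_exp_coeff (by simp) (by simp))]
  exact linearCombination_single_one f

theorem hoffExpL_shW [CharZero K] (u v : Word d) :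
    hoffExpL (shW (K := K) u v) = qshL (hoffExpW u) (hoffExpW v) := by
  have hq : ∀ f g : TA K d, qshL f g = bilin K qshW f g := fun f g => (bilin_apply _ f g).symm
  have hrev : ∀ w : Word d, (blockSum (fun i => (i.factorial : K)⁻¹) w : TA K d) =
      Finsupp.mapDomain List.reverse (blockSum (fun i => (i.factorial : K)⁻¹) w.reverse) :=
    fun w => by rw [← blockSum_reverse, List.reverse_reverse]
  have hqrev : ∀ f g : TA K d,
      bilin K qshW (Finsupp.mapDomain List.reverse f) (Finsupp.mapDomain List.reverse g) =
        Finsupp.mapDomain List.reverse (bilin K (qshRev (K := K)) f g) := by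
    intro f g
    induction f using Finsupp.induction_linear with
    | zero => simp
    | add f₁ f₂ h₁ h₂ => simp [Finsupp.mapDomain_add, h₁, h₂]
    | single x a =>
      induction g using Finsupp.induction_linear with
      | zero => simp
      | add g₁ g₂ h₁ h₂ => simp only [Finsupp.mapDomain_add, map_add, h₁, h₂]
      | single y b => simp [Finsupp.mapDomain_single, qshW, Finsupp.mapDomain_smul]
  have hexp : ∀ i j : ℕ, ((i + j).choose i : K) * ((i + j).factorial : K)⁻¹ =
      (i.factorial : K)⁻¹ * (j.factorial : K)⁻¹ := by
    intro i j
    have hi : (i.factorial : K) ≠ 0 := Nat.cast_ne_zero.mpr i.factorial_ne_zero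
    have hj : (j.factorial : K) ≠ 0 := Nat.cast_ne_zero.mpr j.factorial_ne_zero
    have hij : ((i + j).factorial : K) ≠ 0 := Nat.cast_ne_zero.mpr (i + j).factorial_ne_zero
    have h : ((i + j).choose i : K) * i.factorial * j.factorial = (i + j).factorial := by
      rw [Nat.choose_symm_add]
      exact_mod_cast Nat.add_choose_mul_factorial_mul_factorial i j
    field_simp
    linear_combination h
  rw [hq, hoffExpL_eq_linearCombination, hoffExpW_eq_blockSum, hoffExpW_eq_blockSum, hrev u,
    hrev v, hqrev, ← linearCombination_blockSum_shRev hexp (by simp), shW,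
    Finsupp.linearCombination_mapDomain]
  have hcomp : (blockSum (fun i => (i.factorial : K)⁻¹) ∘ List.reverse : Word d → TA K d) =
      fun w => Finsupp.lmapDomain K K List.reverse (blockSum (fun i => (i.factorial : K)⁻¹) w) :=
    funext fun w => blockSum_reverse _ w
  rw [hcomp, ← map_linearCombination]
  rfl

theorem deconcatL_hoffExpW (w : Word d) :
    deconcatL (hoffExpW (K := K) w) = hoffExp2 (deconcat w) := by
  have hdec : (deconcat : Word d → (Word d × Word d) →₀ K) =
      splitSum fun x y => Finsupp.single (x, y) 1 :=
    funext fun w => (splitSum_eq_sum_range (fun x y => (Finsupp.single (x, y) (1 : K) :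
      (Word d × Word d) →₀ K)) w).symm
  have h₂ : ∀ F : (Word d × Word d) →₀ K, hoffExp2 F = Finsupp.linearCombination K
      (fun p : Word d × Word d => bilin K (fun x y => (Finsupp.single (x, y) 1 :
        (Word d × Word d) →₀ K)) (hoffExpW p.1) (hoffExpW p.2)) F := by
    intro F
    simp only [hoffExp2, bilin_apply, Finsupp.linearCombination_apply, Finsupp.smul_sum,
      Finsupp.smul_single, smul_eq_mul, mul_one, mul_assoc]
  have h₁ : deconcatL (hoffExpW (K := K) w) =
      Finsupp.linearCombination K deconcat (hoffExpW (K := K) w) := rfl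
  rw [h₁, h₂, hdec, hoffExpW_eq_blockSum, linearCombination_splitSum_blockSum, map_splitSum]
  simp [hoffExpW_eq_blockSum]

/-- Hoffman's isomorphism: `Φ_H` is a Hopf algebra isomorphism from the shuffle Hopf
algebra `(T(𝔄), ⧢, δ)` to the quasi-shuffle Hopf algebra `(T(𝔄), ⋆, δ)`, with inverse
the Hoffman logarithm. -/
theorem hoffman_isomorphism {K : Type*} [Field K] [CharZero K] {d : ℕ} :
    -- Φ_H is multiplicative from ⧢ to ⋆
    (∀ u v : Word d, hoffExpL (shW (K := K) u v) = qshL (hoffExpW u) (hoffExpW v)) ∧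
    -- Φ_H is unital
    (hoffExpW ([] : Word d) = Finsupp.single ([] : Word d) (1 : K)) ∧
    -- Φ_H is a coalgebra morphism: δ ∘ Φ_H = (Φ_H ⊗ Φ_H) ∘ δ
    (∀ w : Word d, deconcatL (hoffExpW (K := K) w) = hoffExp2 (deconcat w)) ∧
    -- Φ_H is bijective
    Function.Bijective (hoffExpL (K := K) (d := d)) ∧
    -- with inverse the Hoffman logarithm
    (∀ f : TA K d, hoffExpL (hoffLogL f) = f ∧ hoffLogL (hoffExpL f) = f) := by
  exact ⟨hoffExpL_shW, by rw [hoffExpW_eq_blockSum, blockSum_nil], deconcatL_hoffExpW,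
    ⟨Function.LeftInverse.injective hoffLogL_hoffExpL,
      Function.RightInverse.surjective hoffExpL_hoffLogL⟩,
    fun f => ⟨hoffExpL_hoffLogL f, hoffLogL_hoffExpL f⟩⟩

end TimeWarp
end
end

section
/- (Hoffman's exponential intertwines the two signatures.) Let x = (0, x₁, …, x_N, x_N, …) be a real time series, and let X: [0,N] → ℝ^𝔄 be the path whose component X^{a}, for a = [1^{k₁}⋯d^{k_d}] ∈ 𝔄, is the piecewise linear interpolation at integer times of n ↦ Σ_{j=1}^{n} (Δx_j^{(1)})^{k₁}⋯(Δx_j^{(d)})^{k_d}. Then for every word w ∈ T(𝔄), ⟨Φ_H(w), DS(x)_{0,N}⟩ = ⟨w, S(X)_{0,N}⟩. -/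
noncomputable section

open scoped BigOperators

namespace TimeWarp

variable {K : Type*} [Field K] {d : ℕ}
/-- `Δx_j^{[u]}`: the product of the coordinates of the increment `Δx_j = x_j - x_{j-1}`
indicated by the letters of the bracket `u ∈ 𝔄`. -/
def bracketDelta (x : ℕ → Fin d → K) (j : ℕ) (u : Bracket d) : K :=
  (u.1.map fun i => x j i - x (j - 1) i).prod

/-- The iterated-sums signature `⟨w, DS(x)_{n,m}⟩ = Σ_{n<i₁<⋯<i_k≤m} Δx_{i₁}^{[u₁]}⋯Δx_{i_k}^{[u_k]}`
for the word `w = [u₁]⋯[u_k]`. -/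
def DS (x : ℕ → Fin d → K) : ℕ → ℕ → Word d → K
  | _, _, [] => 1
  | n, m, u :: w => ∑ j ∈ Finset.Ioc n m, bracketDelta x j u * DS x j m w
/-- Auxiliary recursion for the iterated-integrals signature, on reversed words
(the head of the list is the last letter): `⟨wb, S(z)_{s,t}⟩ = ∫_s^t ⟨w, S(z)_{s,u}⟩ ż^b(u) du`. -/
def sigAux {B : Type*} (z : B → ℝ → ℝ) : ℝ → ℝ → List B → ℝ
  | _, _, [] => 1
  | s, t, b :: w => ∫ u in s..t, sigAux z s u w * deriv (z b) u

/-- The iterated-integrals signature `⟨w, S(z)_{s,t}⟩` of the path with coordinate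
functions `z b : ℝ → ℝ`. -/
def pathSig {B : Type*} (z : B → ℝ → ℝ) (s t : ℝ) (w : List B) : ℝ :=
  sigAux z s t w.reverse

/-- Piecewise linear interpolation at the integers of a sequence `y : ℕ → ℝ`. -/
def pl (y : ℕ → ℝ) (t : ℝ) : ℝ :=
  y ⌊t⌋₊ + (t - (⌊t⌋₊ : ℝ)) * (y (⌊t⌋₊ + 1) - y ⌊t⌋₊)

open MeasureTheory

/-- The convolution of two functionals on words, dual to deconcatenation. -/
def convolve {α : Type*} (f g : List α → ℝ) (w : List α) : ℝ :=
  ∑ k ∈ Finset.range (w.length + 1), f (w.take k) * g (w.drop k)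

/-- The counit: the functional that is `1` on the empty word and `0` elsewhere. -/
def counit {α : Type*} : List α → ℝ
  | [] => 1
  | _ :: _ => 0

/-- The tensor exponential of the functional `c` on letters. -/
def letterExp {α : Type*} (c : α → ℝ) (w : List α) : ℝ :=
  ((w.length.factorial : ℝ))⁻¹ * (w.map c).prod

section Convolution

variable {α : Type*}

@[simp]
theorem convolve_nil (f g : List α → ℝ) : convolve f g [] = f [] * g [] := by
  simp [convolve]

theorem convolve_cons (f g : List α → ℝ) (a : α) (w : List α) :
    convolve f g (a :: w) = f [] * g (a :: w) + convolve (fun v => f (a :: v)) g w := by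
  simp only [convolve, List.length_cons]
  rw [Finset.sum_range_succ', add_comm]
  simp

theorem convolve_concat (f g : List α → ℝ) (b : α) (w : List α) :
    convolve f g (w ++ [b]) = convolve f (fun v => g (v ++ [b])) w + f (w ++ [b]) * g [] := by
  simp only [convolve, List.length_append, List.length_singleton]
  rw [Finset.sum_range_succ]
  congr 1
  · refine Finset.sum_congr rfl fun k hk => ?_
    have hk : k ≤ w.length := by simpa [Nat.lt_succ_iff] using hk
    rw [List.take_append_of_le_length hk, List.drop_append_of_le_length hk]
  · rw [List.take_of_length_le (by simp), List.drop_of_length_le (by simp)]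

theorem convolve_add_left (f₁ f₂ g : List α → ℝ) (w : List α) :
    convolve (fun v => f₁ v + f₂ v) g w = convolve f₁ g w + convolve f₂ g w := by
  simp only [convolve, ← Finset.sum_add_distrib, add_mul]

theorem convolve_mul_left (r : ℝ) (f g : List α → ℝ) (w : List α) :
    convolve (fun v => r * f v) g w = r * convolve f g w := by
  simp only [convolve, Finset.mul_sum, mul_assoc]

theorem convolve_assoc (f g h : List α → ℝ) :
    convolve (convolve f g) h = convolve f (convolve g h) := by
  funext w
  induction w generalizing f g with
  | nil => simp [mul_assoc]
  | cons a w ih =>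
    have hfun : (fun v => convolve f g (a :: v)) =
        fun v => f [] * g (a :: v) + convolve (fun u => f (a :: u)) g v :=
      funext fun v => convolve_cons f g a v
    rw [convolve_cons, hfun, convolve_add_left, convolve_mul_left, ih,
      convolve_cons f, convolve_cons g, convolve_nil]
    ring

theorem counit_convolve (f : List α → ℝ) : convolve counit f = f := by
  funext w
  cases w with
  | nil => simp [counit]
  | cons a w => rw [convolve_cons]; simp [counit, convolve]

theorem convolve_counit (f : List α → ℝ) : convolve f counit = f := by
  funext w
  induction w generalizing f with
  | nil => simp [counit]
  | cons a w ih => rw [convolve_cons, ih]; simp [counit]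

@[simp]
theorem letterExp_nil (c : α → ℝ) : letterExp c [] = 1 := by simp [letterExp]

theorem letterExp_zero : letterExp (fun _ : α => (0 : ℝ)) = counit := by
  funext w
  cases w <;> simp [letterExp, counit]

theorem letterExp_smul (r : ℝ) (c : α → ℝ) (w : List α) :
    letterExp (fun b => r * c b) w = r ^ w.length * letterExp c w := by
  simp only [letterExp, List.prod_map_mul]
  simp
  ring

theorem letterExp_concat (c : α → ℝ) (w : List α) (b : α) :
    letterExp c (w ++ [b]) = ((w.length + 1 : ℕ) : ℝ)⁻¹ * (letterExp c w * c b) := by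
  simp only [letterExp, List.length_append, List.length_singleton, Nat.factorial_succ,
    List.map_append, List.prod_append, Nat.cast_mul, mul_inv]
  simp
  ring

theorem hasDerivAt_letterExp_concat (c : α → ℝ) (w : List α) (b : α) (a u : ℝ) :
    HasDerivAt (fun u => letterExp (fun b => (u - a) * c b) (w ++ [b]))
      (letterExp (fun b => (u - a) * c b) w * c b) u := by
  simp_rw [letterExp_smul, letterExp_concat, List.length_append, List.length_singleton]
  have h := (((hasDerivAt_id u).sub_const a).fun_pow (w.length + 1)).mul_const
    (((w.length + 1 : ℕ) : ℝ)⁻¹ * (letterExp c w * c b))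
  refine h.congr_deriv ?_
  have : ((w.length : ℝ) + 1) ≠ 0 := by positivity
  simp
  field_simp

theorem continuous_letterExp_smul (c : α → ℝ) (w : List α) (a : ℝ) :
    Continuous fun u : ℝ => letterExp (fun b => (u - a) * c b) w := by
  simp only [letterExp_smul]
  fun_prop

theorem continuous_convolve_letterExp (f : List α → ℝ) (c : α → ℝ) (w : List α) (a : ℝ) :
    Continuous fun u : ℝ => convolve f (letterExp fun b => (u - a) * c b) w :=
  continuous_finsetSum _ fun k _ =>
    continuous_const.mul (continuous_letterExp_smul c (w.drop k) a)

theorem integral_convolve_letterExp (f : List α → ℝ) (c : α → ℝ) (w : List α) (b : α) (a t : ℝ) :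
    ∫ u in a..t, convolve f (letterExp fun b => (u - a) * c b) w * c b =
      convolve f (fun v => letterExp (fun b => (t - a) * c b) (v ++ [b])) w := by
  have hderiv : ∀ u ∈ Set.uIcc a t,
      HasDerivAt (fun u => convolve f (fun v => letterExp (fun b => (u - a) * c b) (v ++ [b])) w)
        (convolve f (letterExp fun b => (u - a) * c b) w * c b) u := by
    intro u _
    simp only [convolve, Finset.sum_mul, mul_assoc]
    exact HasDerivAt.fun_sum fun k _ =>
      (hasDerivAt_letterExp_concat c (w.drop k) b a u).const_mul _
  rw [intervalIntegral.integral_eq_sub_of_hasDerivAt hderiv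
    (((continuous_convolve_letterExp f c w a).mul continuous_const).intervalIntegrable _ _)]
  simp [convolve, letterExp_concat]

end Convolution

section PathSignature

variable {B : Type*}

@[simp]
theorem pathSig_nil (z : B → ℝ → ℝ) (s t : ℝ) : pathSig z s t [] = 1 := by
  simp [pathSig, sigAux]

theorem pathSig_concat (z : B → ℝ → ℝ) (s t : ℝ) (w : List B) (b : B) :
    pathSig z s t (w ++ [b]) = ∫ u in s..t, pathSig z s u w * deriv (z b) u := by
  simp [pathSig, sigAux]

theorem pathSig_self (z : B → ℝ → ℝ) (s : ℝ) : pathSig z s s = counit := by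
  funext w
  induction w using List.reverseRecOn with
  | nil => simp [counit]
  | append_singleton w b =>
    rw [pathSig_concat, intervalIntegral.integral_same]
    cases w <;> rfl

theorem deriv_pl (y : ℕ → ℝ) {n : ℕ} {u : ℝ} (hu : u ∈ Set.Ioo (n : ℝ) ((n : ℝ) + 1)) :
    deriv (pl y) u = y (n + 1) - y n := by
  have h : pl y =ᶠ[nhds u] fun t => y n + (t - (n : ℝ)) * (y (n + 1) - y n) := by
    filter_upwards [Ioo_mem_nhds hu.1 hu.2] with t ht
    have hfloor : ⌊t⌋₊ = n :=
      (Nat.floor_eq_iff (n.cast_nonneg.trans ht.1.le)).2 ⟨ht.1.le, ht.2⟩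
    simp [pl, hfloor]
  rw [h.deriv_eq]
  simp

/-- On each unit interval the signature of an interpolated path evolves by convolution
with the exponential of the increment. -/
theorem pathSig_pl (y : B → ℕ → ℝ) (w : List B) :
    ∀ (n : ℕ) (t : ℝ), t ∈ Set.Icc (n : ℝ) ((n : ℝ) + 1) →
      pathSig (fun b => pl (y b)) 0 t w =
        convolve (pathSig (fun b => pl (y b)) 0 n)
          (letterExp fun b => (t - n) * (y b (n + 1) - y b n)) w := by
  induction w using List.reverseRecOn with
  | nil => simp
  | append_singleton w b ih =>
    have hcongr : ∀ (n : ℕ) (t : ℝ), t ∈ Set.Icc (n : ℝ) ((n : ℝ) + 1) →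
        Set.EqOn (fun u => convolve (pathSig (fun b => pl (y b)) 0 n)
            (letterExp fun b => (u - n) * (y b (n + 1) - y b n)) w * (y b (n + 1) - y b n))
          (fun u => pathSig (fun b => pl (y b)) 0 u w * deriv (pl (y b)) u)
          (Set.uIoo (n : ℝ) t) := by
      intro n t ht u hu
      rw [Set.uIoo_of_le ht.1] at hu
      have hu' : u ∈ Set.Ioo (n : ℝ) ((n : ℝ) + 1) := ⟨hu.1, hu.2.trans_le ht.2⟩
      simp only [deriv_pl (y b) hu', ih n u ⟨hu'.1.le, hu'.2.le⟩]
    have hint : ∀ (n : ℕ) (t : ℝ), t ∈ Set.Icc (n : ℝ) ((n : ℝ) + 1) →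
        IntervalIntegrable (fun u => pathSig (fun b => pl (y b)) 0 u w * deriv (pl (y b)) u)
          volume n t := fun n t ht =>
      (((continuous_convolve_letterExp _ _ w _).mul continuous_const).intervalIntegrable _ _).congr_uIoo
        (hcongr n t ht)
    have hint₀ : ∀ n : ℕ,
        IntervalIntegrable (fun u => pathSig (fun b => pl (y b)) 0 u w * deriv (pl (y b)) u)
          volume 0 n := by
      intro n
      have := IntervalIntegrable.trans_iterate (μ := volume) (a := fun k : ℕ => (k : ℝ)) (n := n)
        (f := fun u => pathSig (fun b => pl (y b)) 0 u w * deriv (pl (y b)) u)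
        fun k _ => by
          simpa using hint k ((k : ℝ) + 1) ⟨by linarith, le_rfl⟩
      simpa using this
    intro n t ht
    rw [pathSig_concat, ← intervalIntegral.integral_add_adjacent_intervals (hint₀ n) (hint n t ht),
      ← intervalIntegral.integral_congr_uIoo (hcongr n t ht),
      integral_convolve_letterExp _ (fun b => y b (n + 1) - y b n), convolve_concat, pathSig_concat,
      letterExp_nil]
    ring

theorem pathSig_pl_succ (y : B → ℕ → ℝ) (n : ℕ) :
    pathSig (fun b => pl (y b)) 0 ((n + 1 : ℕ) : ℝ) =
      convolve (pathSig (fun b => pl (y b)) 0 n) (letterExp fun b => y b (n + 1) - y b n) := by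
  funext w
  rw [pathSig_pl y w n _ (by simp)]
  simp

end PathSignature

section CompositionSum

/-- The sum over the compositions of `n` of a function of the list of blocks. -/
def compositionSum (n : ℕ) (F : List ℕ → ℝ) : ℝ :=
  ∑ c : Composition n, F c.blocks

theorem compositionSum_zero (F : List ℕ → ℝ) : compositionSum 0 F = F [] := by
  have hblocks : ∀ c : Composition 0, c.blocks = [] := by
    intro c
    rw [List.eq_nil_iff_forall_not_mem]
    intro i hi
    have h₁ := c.blocks_pos hi
    have h₂ := List.le_sum_of_mem hi
    rw [c.blocks_sum] at h₂
    omega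
  have hunique : (Finset.univ : Finset (Composition 0)) = {Composition.ones 0} :=
    Finset.eq_singleton_iff_unique_mem.2 ⟨Finset.mem_univ _, fun c _ =>
      Composition.ext (by rw [hblocks, hblocks])⟩
  rw [compositionSum, hunique, Finset.sum_singleton, hblocks]

/-- Splitting off the first block of a composition. -/
theorem compositionSum_succ (n : ℕ) (F : List ℕ → ℝ) :
    compositionSum (n + 1) F =
      ∑ k ∈ Finset.range (n + 1), compositionSum (n - k) fun b => F ((k + 1) :: b) := by
  simp only [compositionSum]
  rw [Finset.sum_sigma' (Finset.range (n + 1))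
    (fun k => (Finset.univ : Finset (Composition (n - k))))]
  symm
  refine Finset.sum_bij
    (fun p hp => ⟨(p.1 + 1) :: p.2.blocks, ?_, ?_⟩) ?_ ?_ ?_ ?_
  · intro i hi
    rcases List.mem_cons.1 hi with rfl | hi
    · exact Nat.succ_pos _
    · exact p.2.blocks_pos hi
  · have hp : p.1 < n + 1 := by simpa using hp
    rw [List.sum_cons, p.2.blocks_sum]
    omega
  · intro _ _
    exact Finset.mem_univ _
  · rintro ⟨k, c⟩ _ ⟨k', c'⟩ _ h
    have h' := congrArg Composition.blocks h
    simp only [List.cons.injEq, add_left_inj] at h'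
    obtain ⟨rfl, h'⟩ := h'
    rw [Composition.ext h']
  · intro c _
    rcases c with ⟨_ | ⟨i, b⟩, hpos, hsum⟩
    · simp at hsum
    · have hi := hpos List.mem_cons_self
      rw [List.sum_cons] at hsum
      refine ⟨⟨i - 1, ⟨b, fun hj => hpos (List.mem_cons_of_mem _ hj), by omega⟩⟩, ?_, ?_⟩
      · simp
        omega
      · apply Composition.ext
        simp
        omega
  · intro _ _
    rfl

end CompositionSum

section HoffmanExponential

variable {d : ℕ}

/-- The contraction of a word along a list of block sizes. -/
def contract (w : Word d) (b : List ℕ) : Word d :=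
  (w.splitWrtCompositionAux b).filterMap blockProd

/-- `⟨Φ_H(w), DS(x)_{n,m}⟩`. -/
def hoffmanDS (x : ℕ → Fin d → ℝ) (n m : ℕ) (w : Word d) : ℝ :=
  compositionSum w.length fun b =>
    ((b.map fun i => (i.factorial : ℝ)).prod)⁻¹ * DS x n m (contract w b)

theorem contract_cons (a : Bracket d) (w : Word d) (k : ℕ) (b : List ℕ) :
    contract (a :: w) ((k + 1) :: b) =
      (w.take k).foldl (· * ·) a :: contract (w.drop k) b := by
  simp [contract, List.splitWrtCompositionAux_cons, blockProd]

theorem bracketDelta_mul (x : ℕ → Fin d → ℝ) (j : ℕ) (a b : Bracket d) :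
    bracketDelta x j (a * b) = bracketDelta x j a * bracketDelta x j b := by
  change (((a.1 + b.1).map fun i => x j i - x (j - 1) i).prod) = _
  rw [Multiset.map_add, Multiset.prod_add]
  rfl

theorem bracketDelta_foldl (x : ℕ → Fin d → ℝ) (j : ℕ) (a : Bracket d) (w : Word d) :
    bracketDelta x j (w.foldl (· * ·) a) = ((a :: w).map (bracketDelta x j)).prod := by
  induction w generalizing a with
  | nil => simp
  | cons b w ih => simp [ih, bracketDelta_mul, mul_assoc]

@[simp]
theorem hoffmanDS_nil (x : ℕ → Fin d → ℝ) (n m : ℕ) : hoffmanDS x n m [] = 1 := by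
  simp [hoffmanDS, compositionSum_zero, contract, List.splitWrtCompositionAux, DS]

theorem hoffmanDS_cons (x : ℕ → Fin d → ℝ) (n m : ℕ) (a : Bracket d) (w : Word d) :
    hoffmanDS x n m (a :: w) = ∑ j ∈ Finset.Ioc n m,
      convolve (fun v => letterExp (bracketDelta x j) (a :: v)) (hoffmanDS x j m) w := by
  simp only [convolve]
  rw [Finset.sum_comm, hoffmanDS, List.length_cons, compositionSum_succ]
  refine Finset.sum_congr rfl fun k hk => ?_
  have hk : k ≤ w.length := by simpa [Nat.lt_succ_iff] using hk
  simp only [hoffmanDS, List.length_drop]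
  simp only [compositionSum, Finset.mul_sum]
  rw [Finset.sum_comm]
  refine Finset.sum_congr rfl fun c _ => ?_
  rw [contract_cons, DS, Finset.mul_sum]
  refine Finset.sum_congr rfl fun j _ => ?_
  rw [bracketDelta_foldl, letterExp, List.length_cons, List.length_take_of_le hk,
    List.map_cons (f := fun i : ℕ => (i.factorial : ℝ)), List.prod_cons, mul_inv]
  ring

theorem hoffmanDS_self (x : ℕ → Fin d → ℝ) (n : ℕ) : hoffmanDS x n n = counit := by
  funext w
  cases w with
  | nil => simp [counit]
  | cons a w => simp [hoffmanDS_cons, counit]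

theorem hoffmanDS_of_lt (x : ℕ → Fin d → ℝ) {n m : ℕ} (h : n < m) :
    hoffmanDS x n m = convolve (letterExp (bracketDelta x (n + 1))) (hoffmanDS x (n + 1) m) := by
  funext w
  cases w with
  | nil => simp
  | cons a w =>
    rw [convolve_cons, letterExp_nil, hoffmanDS_cons, hoffmanDS_cons,
      ← Finset.insert_Ioc_add_one_left_eq_Ioc h, Finset.sum_insert (by simp)]
    ring

theorem hoffmanDS_succ (x : ℕ → Fin d → ℝ) {n m : ℕ} (h : n ≤ m) :
    hoffmanDS x n (m + 1) = convolve (hoffmanDS x n m) (letterExp (bracketDelta x (m + 1))) := by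
  induction h using Nat.decreasingInduction with
  | self => rw [hoffmanDS_of_lt x m.lt_succ_self, hoffmanDS_self, hoffmanDS_self, convolve_counit,
      counit_convolve]
  | of_succ n hn ih =>
    rw [hoffmanDS_of_lt x (by omega : n < m + 1), ih, hoffmanDS_of_lt x hn, convolve_assoc]

end HoffmanExponential

theorem hoffmanDS_eq_pathSig {d : ℕ} (x : ℕ → Fin d → ℝ) (m : ℕ) :
    hoffmanDS x 0 m = pathSig
      (fun a : Bracket d => pl fun n => ∑ j ∈ Finset.Icc 1 n, bracketDelta x j a) 0 (m : ℝ) := by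
  induction m with
  | zero => rw [hoffmanDS_self, Nat.cast_zero, pathSig_self]
  | succ m ih =>
    rw [hoffmanDS_succ x m.zero_le, ih, pathSig_pl_succ]
    congr 2
    funext a
    rw [Finset.sum_Icc_succ_top (by omega), add_sub_cancel_left]

/-- Hoffman's exponential intertwines the iterated-sums signature of the time series `x`
with the iterated-integrals signature of the piecewise linear interpolation `X` of the
infinite-dimensional time series `n ↦ Σ_{j≤n} Δx_j^{[a]}`, `a ∈ 𝔄`:
`⟨Φ_H(w), DS(x)_{0,N}⟩ = ⟨w, S(X)_{0,N}⟩`. -/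
theorem hoffman_intertwines_signatures {d : ℕ} (N : ℕ) (x : ℕ → Fin d → ℝ)
    (hx0 : x 0 = 0) (hxN : ∀ n, N ≤ n → x n = x N) (w : Word d) :
    (∑ c : Composition w.length,
        ((c.blocks.map fun i => (i.factorial : ℝ)).prod)⁻¹ * DS x 0 N (Iword c w))
      = pathSig
          (fun (a : Bracket d) (t : ℝ) =>
            pl (fun n => ∑ j ∈ Finset.Icc 1 n, bracketDelta x j a) t)
          0 (N : ℝ) w :=
  congrFun (hoffmanDS_eq_pathSig x N) w

end TimeWarp
end
end
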